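/- Reduction axiom for the propositional quantifier under product update: let A = (Σ, E, PRE) be an event model with events α_0, …, α_{n−1} whose precondition formulas Pre_{α_i} belong to L∃U, let α ∈ Σ, and let φ(p) be a formula (possibly containing action nominals under action modalities) such that none of the fresh proposition letters p_0, …, p_{n−1} occur in φ or in any Pre_{α_i}. Then the equivalence ⟨α⟩∃p.φ(p) ≡ ∃p_0 … ∃p_{n−1}.( ⋀_{i<n} U(p_i ⊃ Pre_{α_i}) ∧ ⟨α⟩ φ(⋁_{i<n}(p_i ∧ j_i)) ) is valid at every point of every relational model. -/

import Mathlib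

/-- A relational model over a set of worlds `W`. -/
structure Model (W : Type) where
  rel : W → W → Prop
  val : ℕ → Set W

/-- Change the valuation of the proposition letter `p` to `X`. -/
def Model.update {W : Type} (M : Model W) (p : ℕ) (X : Set W) : Model W :=
  ⟨M.rel, fun q => if q = p then X else M.val q⟩

/-- Restriction (relativisation) of a model to a subset of its domain. -/
def Model.restrict {W : Type} (M : Model W) (A : Set W) : Model A :=
  ⟨fun a b => M.rel a.1 b.1, fun p => {a | a.1 ∈ M.val p}⟩

/-- The language `L∃U`: propositionally quantified modal logic with the global modality. -/
inductive Form : Type where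
  | atom : ℕ → Form
  | neg : Form → Form
  | and : Form → Form → Form
  | box : Form → Form
  | ex : ℕ → Form → Form
  | uni : Form → Form

/-- Satisfaction for `L∃U`. -/
def Sat {W : Type} : Model W → W → Form → Prop
  | M, w, .atom p => w ∈ M.val p
  | M, w, .neg φ => ¬ Sat M w φ
  | M, w, .and φ ψ => Sat M w φ ∧ Sat M w ψ
  | M, w, .box φ => ∀ v, M.rel w v → Sat M v φ
  | M, w, .ex p φ => ∃ X : Set W, Sat (M.update p X) w φ
  | M, w, .uni φ => ∀ v, Sat M v φ

/-- Material implication, `φ ⊃ ψ`. -/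
def Form.imp (φ ψ : Form) : Form := .neg (.and φ (.neg ψ))

/-- The proposition letter `p` occurs in a formula. -/
def Form.Occurs (p : ℕ) : Form → Prop
  | .atom q => q = p
  | .neg φ => φ.Occurs p
  | .and φ ψ => φ.Occurs p ∨ ψ.Occurs p
  | .box φ => φ.Occurs p
  | .ex q φ => q = p ∨ φ.Occurs p
  | .uni φ => φ.Occurs p

/-- The formula contains no global modality `U` (i.e. is in `L∃`). -/
def Form.UFree : Form → Prop
  | .atom _ => True
  | .neg φ => φ.UFree
  | .and φ ψ => φ.UFree ∧ ψ.UFree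
  | .box φ => φ.UFree
  | .ex _ φ => φ.UFree
  | .uni _ => False

/-- Semantics of the dynamic relativisation (public announcement) modality `⟨!A⟩φ`. -/
def SatRel {W : Type} (M : Model W) (w : W) (A φ : Form) : Prop :=
  ∃ h : w ∈ {v | Sat M v A}, Sat (M.restrict {v | Sat M v A}) ⟨w, h⟩ φ

/-- An event model with `n` events `α_0, …, α_{n-1}`, preconditions in `L∃U`. -/
structure EventModel (n : ℕ) where
  E : Fin n → Fin n → Prop
  pre : Fin n → Form

/-- The domain of the product update `M ⊗ A`. -/
def prodDomain {W : Type} (M : Model W) {n : ℕ} (A : EventModel n) : Set (W × Fin n) :=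
  {x | Sat M x.1 (A.pre x.2)}

/-- The product update `M ⊗ A`. -/
def prodModel {W : Type} (M : Model W) {n : ℕ} (A : EventModel n) :
    Model (prodDomain M A) :=
  ⟨fun x y => M.rel x.1.1 y.1.1 ∧ A.E x.1.2 y.1.2, fun p => {x | x.1.1 ∈ M.val p}⟩

/-- Semantics of the action modality `⟨α⟩φ` for `φ ∈ L∃U`. -/
def SatAct {W : Type} {n : ℕ} (M : Model W) (A : EventModel n) (α : Fin n) (w : W)
    (φ : Form) : Prop :=
  ∃ h : (w, α) ∈ prodDomain M A, Sat (prodModel M A) ⟨(w, α), h⟩ φ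

/-- The set of sentences `S∃Uj`: `L∃U` plus action nominals `j_i`. -/
inductive FormJ (n : ℕ) : Type where
  | atom : ℕ → FormJ n
  | nom : Fin n → FormJ n
  | neg : FormJ n → FormJ n
  | and : FormJ n → FormJ n → FormJ n
  | box : FormJ n → FormJ n
  | ex : ℕ → FormJ n → FormJ n
  | uni : FormJ n → FormJ n

/-- Satisfaction for `S∃Uj`, relative to a labelling of worlds by events
(in a product model `M ⊗ A` the label of `(ω, α)` is `α`). -/
def SatJ {n : ℕ} {V : Type} (lab : V → Fin n) : Model V → V → FormJ n → Prop
  | M, w, .atom p => w ∈ M.val p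
  | _, w, .nom i => lab w = i
  | M, w, .neg φ => ¬ SatJ lab M w φ
  | M, w, .and φ ψ => SatJ lab M w φ ∧ SatJ lab M w ψ
  | M, w, .box φ => ∀ v, M.rel w v → SatJ lab M v φ
  | M, w, .ex p φ => ∃ X : Set V, SatJ lab (M.update p X) w φ
  | M, w, .uni φ => ∀ v, SatJ lab M v φ

/-- Semantics of the action modality `⟨α⟩ψ` applied to a sentence `ψ ∈ S∃Uj`:
`M, w ⊨ ⟨α⟩ψ` iff `M, w ⊨ Pre_α` and `M ⊗ A, (w, α) ⊨ ψ`. -/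
def SatActJ {W : Type} {n : ℕ} (M : Model W) (A : EventModel n) (α : Fin n) (w : W)
    (ψ : FormJ n) : Prop :=
  ∃ h : (w, α) ∈ prodDomain M A,
    SatJ (fun x : prodDomain M A => x.1.2) (prodModel M A) ⟨(w, α), h⟩ ψ

/-- The proposition letter `p` occurs in a sentence of `S∃Uj`. -/
def FormJ.Occurs {n : ℕ} (p : ℕ) : FormJ n → Prop
  | .atom q => q = p
  | .nom _ => False
  | .neg φ => φ.Occurs p
  | .and φ ψ => φ.Occurs p ∨ ψ.Occurs p
  | .box φ => φ.Occurs p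
  | .ex q φ => q = p ∨ φ.Occurs p
  | .uni φ => φ.Occurs p

/-- Substitution `φ(σ)` of the sentence `σ` for the proposition letter `p` in `φ`. -/
def FormJ.subst {n : ℕ} (p : ℕ) (σ : FormJ n) : FormJ n → FormJ n
  | .atom q => if q = p then σ else .atom q
  | .nom i => .nom i
  | .neg φ => .neg (FormJ.subst p σ φ)
  | .and φ ψ => .and (FormJ.subst p σ φ) (FormJ.subst p σ ψ)
  | .box φ => .box (FormJ.subst p σ φ)
  | .ex q φ => if q = p then .ex q φ else .ex q (FormJ.subst p σ φ)
  | .uni φ => .uni (FormJ.subst p σ φ)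

/-- Disjunction, defined from `¬` and `∧`. -/
def FormJ.or {n : ℕ} (φ ψ : FormJ n) : FormJ n := .neg (.and (.neg φ) (.neg ψ))

/-- Finite disjunction `⋁`. -/
def FormJ.bigOr {n : ℕ} : List (FormJ n) → FormJ n
  | [] => .and (.atom 0) (.neg (.atom 0))
  | [φ] => φ
  | φ :: ψ :: rest => φ.or (FormJ.bigOr (ψ :: rest))

/-- Simultaneous update of the valuation of the (distinct) letters `ps i` to `X i`. -/
def Model.updateMany {W : Type} (M : Model W) {n : ℕ} (ps : Fin n → ℕ)
    (X : Fin n → Set W) : Model W :=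
  ⟨M.rel, fun q => {w | (∃ i, ps i = q ∧ w ∈ X i) ∨ ((∀ i, ps i ≠ q) ∧ w ∈ M.val q)}⟩

/-- A concrete numerical encoding of `L∃U` formulas. -/
def Form.toNat : Form → ℕ
  | .atom p => Nat.pair 0 p
  | .neg φ => Nat.pair 1 φ.toNat
  | .and φ ψ => Nat.pair 2 (Nat.pair φ.toNat ψ.toNat)
  | .box φ => Nat.pair 3 φ.toNat
  | .ex p φ => Nat.pair 4 (Nat.pair p φ.toNat)
  | .uni φ => Nat.pair 5 φ.toNat

/-- The language `L∃Uα`: `L∃U` with action modalities `⟨α⟩` for events `α` of an event model. -/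
inductive FormA (n : ℕ) : Type where
  | atom : ℕ → FormA n
  | neg : FormA n → FormA n
  | and : FormA n → FormA n → FormA n
  | box : FormA n → FormA n
  | ex : ℕ → FormA n → FormA n
  | uni : FormA n → FormA n
  | act : Fin n → FormA n → FormA n

/-- Satisfaction for `L∃Uα`, relative to a fixed event model `A`. -/
def SatA {n : ℕ} (A : EventModel n) : (W : Type) → Model W → W → FormA n → Prop
  | _, M, w, .atom p => w ∈ M.val p
  | W, M, w, .neg φ => ¬ SatA A W M w φ
  | W, M, w, .and φ ψ => SatA A W M w φ ∧ SatA A W M w ψ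
  | W, M, w, .box φ => ∀ v, M.rel w v → SatA A W M v φ
  | W, M, w, .ex p φ => ∃ X : Set W, SatA A W (M.update p X) w φ
  | W, M, w, .uni φ => ∀ v, SatA A W M v φ
  | _, M, w, .act β φ => ∃ h : (w, β) ∈ prodDomain M A,
      SatA A (prodDomain M A) (prodModel M A) ⟨(w, β), h⟩ φ

/-- The set of points reachable from `ω` in at most `k` steps along `R`. -/
def reachWithin {W : Type} (M : Model W) (ω : W) : ℕ → Set W
  | 0 => {ω}
  | k + 1 => reachWithin M ω k ∪ {v | ∃ u ∈ reachWithin M ω k, M.rel u v}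

theorem mem_reachWithin_self {W : Type} (M : Model W) (ω : W) (k : ℕ) :
    ω ∈ reachWithin M ω k := by
  induction k with
  | zero => exact rfl
  | succ k ih => exact Or.inl ih

/-- `M^k_ω`: the submodel of `M` generated by going at most `k` steps along `R` from `ω`. -/
def Model.genSub {W : Type} (M : Model W) (ω : W) (k : ℕ) : Model (reachWithin M ω k) :=
  M.restrict (reachWithin M ω k)

/-- `φ ∈ L∃U` has degree `k`. -/
def HasDegreeForm (φ : Form) (k : ℕ) : Prop :=
  ∀ (W : Type) (M : Model W) (ω : W),
    Sat M ω φ ↔ Sat (M.genSub ω k) ⟨ω, mem_reachWithin_self M ω k⟩ φ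

/-- `φ ∈ L∃Uα` has degree `k`. -/
def HasDegreeA {n : ℕ} (A : EventModel n) (φ : FormA n) (k : ℕ) : Prop :=
  ∀ (W : Type) (M : Model W) (ω : W),
    SatA A W M ω φ ↔
      SatA A (reachWithin M ω k) (M.genSub ω k) ⟨ω, mem_reachWithin_self M ω k⟩ φ

/-- `deg(φ)` for `φ ∈ L∃U` (the least degree; `sInf ∅ = 0` by convention). -/
noncomputable def degForm (φ : Form) : ℕ := sInf {k | HasDegreeForm φ k}

/-- `deg(φ)` for `φ ∈ L∃Uα`. -/
noncomputable def degA {n : ℕ} (A : EventModel n) (φ : FormA n) : ℕ :=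
  sInf {k | HasDegreeA A φ k}

/-- `Z` is a bisimulation between `M` and `M'`. -/
def IsBisim {W W' : Type} (M : Model W) (M' : Model W') (Z : W → W' → Prop) : Prop :=
  ∀ s t, Z s t →
    (∀ p, s ∈ M.val p ↔ t ∈ M'.val p) ∧
    (∀ s₁, M.rel s s₁ → ∃ t₁, M'.rel t t₁ ∧ Z s₁ t₁) ∧
    (∀ t₁, M'.rel t t₁ → ∃ s₁, M.rel s s₁ ∧ Z s₁ t₁)

/-- `φ ∈ L∃U` is bisimulation-invariant. -/
def BisimInvariant (φ : Form) : Prop :=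
  ∀ (W W' : Type) (M : Model W) (M' : Model W') (Z : W → W' → Prop),
    IsBisim M M' Z → ∀ w w', Z w w' → (Sat M w φ ↔ Sat M' w' φ)

/-- The modal fixpoint language `L_μ` (with greatest-fixpoint binders `ν`). -/
inductive Formμ : Type where
  | atom : ℕ → Formμ
  | neg : Formμ → Formμ
  | and : Formμ → Formμ → Formμ
  | box : Formμ → Formμ
  | nu : ℕ → Formμ → Formμ

mutual
/-- All occurrences of `p` are under an even number of negations. -/
def PosIn (p : ℕ) : Formμ → Prop
  | .atom _ => True
  | .neg φ => NegIn p φ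
  | .and φ ψ => PosIn p φ ∧ PosIn p ψ
  | .box φ => PosIn p φ
  | .nu q φ => q = p ∨ PosIn p φ

/-- All occurrences of `p` are under an odd number of negations. -/
def NegIn (p : ℕ) : Formμ → Prop
  | .atom q => q ≠ p
  | .neg φ => PosIn p φ
  | .and φ ψ => NegIn p φ ∧ NegIn p ψ
  | .box φ => NegIn p φ
  | .nu q φ => q = p ∨ NegIn p φ
end

/-- Well-formedness for `L_μ`: in each `νp.φ`, `φ` is positive in `p`. -/
def WFμ : Formμ → Prop
  | .atom _ => True
  | .neg φ => WFμ φ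
  | .and φ ψ => WFμ φ ∧ WFμ ψ
  | .box φ => WFμ φ
  | .nu q φ => PosIn q φ ∧ WFμ φ

/-- Satisfaction for `L_μ`: `⟦νp.φ⟧ = ⋃ {X | ∀ ω ∈ X, M[p ↦ X], ω ⊨ φ}`. -/
def Satμ {W : Type} : Model W → W → Formμ → Prop
  | M, w, .atom p => w ∈ M.val p
  | M, w, .neg φ => ¬ Satμ M w φ
  | M, w, .and φ ψ => Satμ M w φ ∧ Satμ M w ψ
  | M, w, .box φ => ∀ v, M.rel w v → Satμ M v φ
  | M, w, .nu q φ => w ∈ ⋃₀ {X : Set W | ∀ v ∈ X, Satμ (M.update q X) v φ}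

/-- An event model with preconditions in `L_μ`. -/
structure EventModelμ (n : ℕ) where
  E : Fin n → Fin n → Prop
  pre : Fin n → Formμ

/-- The domain of the product update `M ⊗ A` for `L_μ` event models. -/
def prodDomainμ {W : Type} (M : Model W) {n : ℕ} (A : EventModelμ n) : Set (W × Fin n) :=
  {x | Satμ M x.1 (A.pre x.2)}

/-- The product update `M ⊗ A` for `L_μ` event models. -/
def prodModelμ {W : Type} (M : Model W) {n : ℕ} (A : EventModelμ n) :
    Model (prodDomainμ M A) :=
  ⟨fun x y => M.rel x.1.1 y.1.1 ∧ A.E x.1.2 y.1.2, fun p => {x | x.1.1 ∈ M.val p}⟩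

/-- Satisfaction for `L∃U` depends only on the letters occurring in the formula. -/
theorem sat_congr {W : Type} (φ : Form) {M N : Model W} (hrel : M.rel = N.rel)
    (hval : ∀ q, φ.Occurs q → M.val q = N.val q) (w : W) : Sat M w φ ↔ Sat N w φ := by
  induction φ generalizing M N w with
  | atom q => simp only [Sat, hval q rfl]
  | neg φ ih => exact not_congr (ih hrel hval w)
  | and φ ψ ihφ ihψ =>
    exact and_congr (ihφ hrel (fun q h => hval q (Or.inl h)) w)
      (ihψ hrel (fun q h => hval q (Or.inr h)) w)
  | box φ ih => simp only [Sat, hrel, ih hrel hval]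
  | ex r φ ih =>
    refine exists_congr fun X =>
      ih (M := M.update r X) (N := N.update r X) hrel (fun q h => ?_) w
    simp only [Model.update, hval q (Or.inr h)]
  | uni φ ih => exact forall_congr' fun v => ih hrel hval v

/-- Satisfaction for `S∃Uj` depends only on the letters occurring in the sentence. -/
theorem satJ_congr {n : ℕ} {V : Type} {lab : V → Fin n} (φ : FormJ n) {M N : Model V}
    (hrel : M.rel = N.rel) (hval : ∀ q, φ.Occurs q → M.val q = N.val q) (w : V) :
    SatJ lab M w φ ↔ SatJ lab N w φ := by
  induction φ generalizing M N w with
  | atom q => simp only [SatJ, hval q rfl]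
  | nom i => exact Iff.rfl
  | neg φ ih => exact not_congr (ih hrel hval w)
  | and φ ψ ihφ ihψ =>
    exact and_congr (ihφ hrel (fun q h => hval q (Or.inl h)) w)
      (ihψ hrel (fun q h => hval q (Or.inr h)) w)
  | box φ ih => simp only [SatJ, hrel, ih hrel hval]
  | ex r φ ih =>
    refine exists_congr fun X =>
      ih (M := M.update r X) (N := N.update r X) hrel (fun q h => ?_) w
    simp only [Model.update, hval q (Or.inr h)]
  | uni φ ih => exact forall_congr' fun v => ih hrel hval v

/-- Substitution lemma: if `p` denotes in `M` what `σ` denotes in `N`, and quantifying over the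
letters of `φ` does not affect `σ`, then `φ` holds in `M` iff `φ(σ)` holds in `N`. -/
theorem satJ_subst {n : ℕ} {V : Type} {lab : V → Fin n} (p : ℕ) (σ φ : FormJ n)
    (hσ : ∀ q, φ.Occurs q → ∀ (N : Model V) (X : Set V) (v : V),
      SatJ lab (N.update q X) v σ ↔ SatJ lab N v σ)
    {M N : Model V} (hrel : M.rel = N.rel)
    (hval : ∀ q, φ.Occurs q → q ≠ p → M.val q = N.val q)
    (hp : φ.Occurs p → ∀ v, v ∈ M.val p ↔ SatJ lab N v σ) (w : V) :
    SatJ lab M w φ ↔ SatJ lab N w (FormJ.subst p σ φ) := by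
  induction φ generalizing M N w with
  | atom q =>
    by_cases hq : q = p
    · subst hq
      simpa [FormJ.subst, SatJ] using hp rfl w
    · simp only [FormJ.subst, if_neg hq, SatJ, hval q rfl hq]
  | nom i => exact Iff.rfl
  | neg φ ih => exact not_congr (ih hσ hrel hval hp w)
  | and φ ψ ihφ ihψ =>
    exact and_congr
      (ihφ (fun q h => hσ q (Or.inl h)) hrel (fun q h => hval q (Or.inl h))
        (fun h => hp (Or.inl h)) w)
      (ihψ (fun q h => hσ q (Or.inr h)) hrel (fun q h => hval q (Or.inr h))
        (fun h => hp (Or.inr h)) w)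
  | box φ ih => simp only [FormJ.subst, SatJ, hrel, ih hσ hrel hval hp]
  | ex r φ ih =>
    by_cases hr : r = p
    · simp only [FormJ.subst, if_pos hr]
      refine exists_congr fun X =>
        satJ_congr φ (M := M.update r X) (N := N.update r X) hrel (fun q h => ?_) w
      by_cases hq : q = r
      · simp only [Model.update, if_pos hq]
      · simp only [Model.update, if_neg hq, hval q (Or.inr h) (hr ▸ hq)]
    · simp only [FormJ.subst, if_neg hr]
      refine exists_congr fun X =>
        ih (fun q h => hσ q (Or.inr h)) (M := M.update r X) (N := N.update r X) hrel
          (fun q h hq => ?_) (fun h v => ?_) w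
      · simp only [Model.update, hval q (Or.inr h) hq]
      · rw [hσ r (Or.inl rfl), ← hp (Or.inr h)]
        simp only [Model.update, if_neg (Ne.symm hr)]
  | uni φ ih => exact forall_congr' fun v => ih hσ hrel hval hp v

theorem satJ_bigOr {n : ℕ} {V : Type} {lab : V → Fin n} (M : Model V) (v : V)
    (l : List (FormJ n)) : SatJ lab M v (FormJ.bigOr l) ↔ ∃ ψ ∈ l, SatJ lab M v ψ := by
  induction l with
  | nil => simp [FormJ.bigOr, SatJ]
  | cons φ l ih =>
    cases l with
    | nil => simp [FormJ.bigOr]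
    | cons ψ l =>
      rw [List.exists_mem_cons_iff, ← ih]
      simp only [FormJ.bigOr, FormJ.or, SatJ]
      tauto

/-- The sentence `⋁ᵢ (pᵢ ∧ jᵢ)` holds at `v` iff the letter indexed by the label of `v` does. -/
theorem satJ_bigOr_nom {n : ℕ} {V : Type} {lab : V → Fin n} (M : Model V) (v : V)
    (ps : Fin n → ℕ) :
    SatJ lab M v (FormJ.bigOr ((List.finRange n).map fun i =>
      FormJ.and (FormJ.atom (ps i)) (FormJ.nom i))) ↔ v ∈ M.val (ps (lab v)) := by
  simp [satJ_bigOr, SatJ]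

theorem mem_updateMany_val {W : Type} (M : Model W) {n : ℕ} {ps : Fin n → ℕ}
    (hinj : Function.Injective ps) (X : Fin n → Set W) (i : Fin n) (w : W) :
    w ∈ (M.updateMany ps X).val (ps i) ↔ w ∈ X i := by
  simp [Model.updateMany, hinj.eq_iff]

theorem updateMany_val_of_ne {W : Type} (M : Model W) {n : ℕ} {ps : Fin n → ℕ}
    (X : Fin n → Set W) {q : ℕ} (hq : ∀ i, ps i ≠ q) :
    (M.updateMany ps X).val q = M.val q := by
  ext w
  simp [Model.updateMany, hq]

/-- Updating letters that do not occur in a formula does not change its truth value. -/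
theorem sat_updateMany {W : Type} (M : Model W) {n : ℕ} {ps : Fin n → ℕ} (X : Fin n → Set W)
    {φ : Form} (hφ : ∀ k, ¬ φ.Occurs (ps k)) (w : W) :
    Sat (M.updateMany ps X) w φ ↔ Sat M w φ :=
  sat_congr φ (M := M.updateMany ps X) (N := M) rfl
    (fun _ hq => updateMany_val_of_ne M X fun i hi => hφ i (hi ▸ hq)) w

/-- The product of a model with an event model, on a prescribed domain. -/
def prodModelOn {W : Type} (M : Model W) {n : ℕ} (A : EventModel n) (D : Set (W × Fin n)) :
    Model D :=
  ⟨fun x y => M.rel x.1.1 y.1.1 ∧ A.E x.1.2 y.1.2, fun p => {x | x.1.1 ∈ M.val p}⟩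

theorem satActJ_iff_of_prodDomain_eq {W : Type} {n : ℕ} {M : Model W} {A : EventModel n}
    {D : Set (W × Fin n)} (hD : prodDomain M A = D) (α : Fin n) (w : W) (ψ : FormJ n) :
    SatActJ M A α w ψ ↔
      ∃ h : (w, α) ∈ D, SatJ (fun x : D => x.1.2) (prodModelOn M A D) ⟨(w, α), h⟩ ψ := by
  subst hD
  exact Iff.rfl

/-- A set of points of the product is coded by its slices, one for each event. -/
theorem satJ_update_iff_subst_updateMany {W : Type} {n : ℕ} (M : Model W) (A : EventModel n)
    (D : Set (W × Fin n)) (p : ℕ) {φ : FormJ n} {ps : Fin n → ℕ}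
    (hinj : Function.Injective ps) (hφ : ∀ i, ¬ φ.Occurs (ps i))
    {Y : Set D} {X : Fin n → Set W} (hXY : ∀ x : D, x ∈ Y ↔ x.1.1 ∈ X x.1.2) (v : D) :
    SatJ (fun x : D => x.1.2) ((prodModelOn M A D).update p Y) v φ ↔
      SatJ (fun x : D => x.1.2) (prodModelOn (M.updateMany ps X) A D) v
        (FormJ.subst p
          (FormJ.bigOr ((List.finRange n).map fun i =>
            FormJ.and (FormJ.atom (ps i)) (FormJ.nom i))) φ) := by
  have hne : ∀ q, φ.Occurs q → ∀ i, ps i ≠ q := fun q h i hi => hφ i (hi ▸ h)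
  refine satJ_subst p _ φ (fun q h N Z x => ?_) (M := (prodModelOn M A D).update p Y)
    (N := prodModelOn (M.updateMany ps X) A D) rfl (fun q h hq => ?_) (fun _ x => ?_) v
  · simp only [satJ_bigOr_nom, Model.update, if_neg (hne q h _)]
  · simp only [Model.update, if_neg hq, prodModelOn, updateMany_val_of_ne M X (hne q h)]
  · rw [satJ_bigOr_nom]
    simp only [Model.update, if_pos, prodModelOn, Set.mem_ofPred_eq,
      mem_updateMany_val M hinj, hXY]

/-- Reduction axiom for the propositional quantifier under product update:
if the distinct fresh letters `ps 0, …, ps (n-1)` occur neither in `φ` nor in any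
precondition, then
`⟨α⟩∃p.φ(p) ≡ ∃p_0 … ∃p_{n−1}.( ⋀_{i<n} U(p_i ⊃ Pre_{α_i}) ∧ ⟨α⟩ φ(⋁_{i<n}(p_i ∧ j_i)) )`
is valid at every point of every relational model. -/
theorem stmt3 (n : ℕ) (hn : 0 < n) (A : EventModel n) (α : Fin n)
    (p : ℕ) (φ : FormJ n) (ps : Fin n → ℕ) (hinj : Function.Injective ps)
    (hφ : ∀ i, ¬ φ.Occurs (ps i)) (hpre : ∀ i k, ¬ (A.pre i).Occurs (ps k))
    (W : Type) (M : Model W) (ω : W) :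
    SatActJ M A α ω (FormJ.ex p φ) ↔
      ∃ X : Fin n → Set W,
        (∀ i : Fin n, ∀ v, v ∈ (M.updateMany ps X).val (ps i) →
            Sat (M.updateMany ps X) v (A.pre i)) ∧
        SatActJ (M.updateMany ps X) A α ω
          (FormJ.subst p
            (FormJ.bigOr ((List.finRange n).map fun i =>
              FormJ.and (FormJ.atom (ps i)) (FormJ.nom i))) φ) := by
  have hD : ∀ X : Fin n → Set W, prodDomain (M.updateMany ps X) A = prodDomain M A :=
    fun X => Set.ext fun x => sat_updateMany M X (hpre x.2) x.1
  constructor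
  · rintro ⟨h, Y, hY⟩
    let X : Fin n → Set W := fun i => {w | ∃ hw : (w, i) ∈ prodDomain M A, ⟨(w, i), hw⟩ ∈ Y}
    refine ⟨X, fun i v hv => ?_, (satActJ_iff_of_prodDomain_eq (hD X) α ω _).2 ⟨h, ?_⟩⟩
    · obtain ⟨hw, -⟩ := (mem_updateMany_val M hinj X i v).1 hv
      exact (sat_updateMany M X (hpre i) v).2 hw
    · refine (satJ_update_iff_subst_updateMany M A _ p hinj hφ (Y := Y) (fun x => ?_) _).1 hY
      exact ⟨fun hx => ⟨x.2, hx⟩, fun ⟨_, hx⟩ => hx⟩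
  · rintro ⟨X, -, hX⟩
    obtain ⟨h, hs⟩ := (satActJ_iff_of_prodDomain_eq (hD X) α ω _).1 hX
    exact ⟨h, {x | x.1.1 ∈ X x.1.2},
      (satJ_update_iff_subst_updateMany M A _ p hinj hφ (fun _ => Iff.rfl) _).2 hs⟩
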